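/- arXiv:2505.13294 — 10 statements merged into one kernel-verified Lean document; each statement's English description precedes it below -/
import Mathlib

section
/- Let n ∈ ℕ and let A be an n×n real matrix. Then the column space of A^(n+1) equals the column space of A^n, i.e., the range of the linear map x ↦ A^(n+1) x equals the range of x ↦ A^n x. -/
/-- The ranges of the powers of an endomorphism of a finite-dimensional vector space are constant
from the dimension of the space onwards. -/
theorem Module.End.range_pow_eq_range_pow_finrank_of_le {K V : Type*} [Field K] [AddCommGroup V]
    [Module K V] [FiniteDimensional K V] {f : Module.End K V} {m : ℕ}
    (hm : Module.finrank K V ≤ m) :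
    LinearMap.range (f ^ m) = LinearMap.range (f ^ Module.finrank K V) := by
  obtain ⟨k, rfl⟩ := Nat.exists_eq_add_of_le hm
  apply Submodule.eq_of_le_of_finrank_eq
  · rw [pow_add]
    exact LinearMap.range_comp_le_range _ _
  · have h_ker := Module.End.ker_pow_eq_ker_pow_finrank_of_le (f := f) hm
    have h₁ := (f ^ (Module.finrank K V + k)).finrank_range_add_finrank_ker
    have h₂ := (f ^ Module.finrank K V).finrank_range_add_finrank_ker
    rw [h_ker] at h₁
    lia

/-- For any `n × n` real matrix `A`, the column space (range of the
linear map `x ↦ M x`) of `A ^ (n + 1)` equals the column space of `A ^ n`. -/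
theorem column_space_pow_succ_eq (n : ℕ) (A : Matrix (Fin n) (Fin n) ℝ) :
    LinearMap.range (A ^ (n + 1)).mulVecLin = LinearMap.range (A ^ n).mulVecLin := by
  have h := Module.End.range_pow_eq_range_pow_finrank_of_le (f := Matrix.toLin' A)
    (m := n + 1) (by simp)
  rwa [Module.finrank_fin_fun, ← Matrix.toLin'_pow, ← Matrix.toLin'_pow] at h
end

section
/- Let A be an n×n real matrix, C a p×n real matrix, and s ≥ n a natural number. Then the column space of C·A^(s+1) equals the column space of C·A^s. -/
/-- The ranges of the powers of an endomorphism of a finite-dimensional space are stable from the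
dimension of the space onwards. -/
theorem Module.End.range_pow_succ_eq_of_finrank_le {K V : Type*} [Field K] [AddCommGroup V]
    [Module K V] [FiniteDimensional K V] (f : Module.End K V) {s : ℕ}
    (hs : Module.finrank K V ≤ s) :
    LinearMap.range (f ^ (s + 1)) = LinearMap.range (f ^ s) := by
  have hle : LinearMap.range (f ^ (s + 1)) ≤ LinearMap.range (f ^ s) := by
    rw [pow_succ]
    exact LinearMap.range_comp_le_range f (f ^ s)
  have hker : LinearMap.ker (f ^ (s + 1)) = LinearMap.ker (f ^ s) :=
    (Module.End.ker_pow_eq_ker_pow_finrank_of_le (hs.trans s.le_succ)).trans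
      (Module.End.ker_pow_eq_ker_pow_finrank_of_le hs).symm
  refine Submodule.eq_of_le_of_finrank_eq hle ?_
  have h₁ := LinearMap.finrank_range_add_finrank_ker (f ^ (s + 1))
  have h₂ := LinearMap.finrank_range_add_finrank_ker (f ^ s)
  rw [hker] at h₁
  omega


/-- For an `n × n` real matrix `A`, a `p × n` real matrix `C`, and `s ≥ n`,
the column space of `C * A ^ (s + 1)` equals the column space of `C * A ^ s`. -/
theorem column_space_CA_pow_eq (n p s : ℕ) (hs : n ≤ s)
    (A : Matrix (Fin n) (Fin n) ℝ) (C : Matrix (Fin p) (Fin n) ℝ) :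
    LinearMap.range (C * A ^ (s + 1)).mulVecLin
      = LinearMap.range (C * A ^ s).mulVecLin := by
  have hpow (k : ℕ) : (A ^ k).mulVecLin = (Matrix.toLin' A) ^ k := Matrix.toLin'_pow A k
  rw [Matrix.mulVecLin_mul, Matrix.mulVecLin_mul, LinearMap.range_comp, LinearMap.range_comp,
    hpow, hpow, Module.End.range_pow_succ_eq_of_finrank_le _ (by simpa using hs)]
end

section
/- Let A be an n×n real matrix, C a p×n real matrix, F an n×m real matrix, and s ≥ n a natural number. Then the column space of C·A^s·F is contained in the sum (supremum over j with 0 ≤ j < s) of the column spaces of the matrices C·A^j·F. -/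
/-- By Cayley–Hamilton, a power `A ^ s` with `s` arbitrary is a linear combination of the powers
`A ^ j` with `j` less than the size of `A`. -/
theorem Matrix.exists_pow_eq_sum_range_smul_pow {R ι : Type*} [CommRing R] [Fintype ι]
    [DecidableEq ι] (A : Matrix ι ι R) (s : ℕ) :
    ∃ c : ℕ → R, A ^ s = ∑ j ∈ Finset.range (Fintype.card ι), c j • A ^ j := by
  nontriviality R
  refine ⟨(Polynomial.X ^ s %ₘ A.charpoly).coeff, ?_⟩
  rw [A.pow_eq_aeval_mod_charpoly s, Polynomial.aeval_def, Polynomial.eval₂_eq_sum,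
    Polynomial.sum_def]
  simp only [← Algebra.smul_def]
  refine Finset.sum_subset (fun j hj ↦ ?_) fun j _ hj ↦ ?_
  · have hdeg := Polynomial.degree_modByMonic_lt (Polynomial.X ^ s) A.charpoly_monic
    rw [A.charpoly_degree_eq_dim] at hdeg
    have hle := Polynomial.le_degree_of_mem_supp j hj
    exact Finset.mem_range.2 (by exact_mod_cast hle.trans_lt hdeg)
  · rw [Polynomial.notMem_support_iff.1 hj, zero_smul]

/-- For an `n × n` real matrix `A`, a `p × n` real matrix `C`, an `n × m`
real matrix `F`, and `s ≥ n`, the column space of `C * A ^ s * F` is contained in the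
sum over `0 ≤ j < s` of the column spaces of the matrices `C * A ^ j * F`. -/
theorem column_space_CAsF_le_sup (n p m s : ℕ) (hs : n ≤ s)
    (A : Matrix (Fin n) (Fin n) ℝ) (C : Matrix (Fin p) (Fin n) ℝ)
    (F : Matrix (Fin n) (Fin m) ℝ) :
    LinearMap.range (C * A ^ s * F).mulVecLin
      ≤ ⨆ j ∈ Finset.range s, LinearMap.range (C * A ^ j * F).mulVecLin := by
  rintro _ ⟨v, rfl⟩
  obtain ⟨c, hc⟩ := A.exists_pow_eq_sum_range_smul_pow s
  rw [Fintype.card_fin] at hc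
  rw [hc, Matrix.mul_sum, Matrix.sum_mul, Matrix.mulVecLin_apply, Matrix.sum_mulVec]
  refine Submodule.sum_mem _ fun j hj ↦ ?_
  rw [Matrix.mul_smul, Matrix.smul_mul, Matrix.smul_mulVec]
  have hjs : j ∈ Finset.range s := Finset.range_mono hs hj
  exact Submodule.smul_mem _ _ (le_iSup₂_of_le (f := fun j (_ : j ∈ Finset.range s) ↦
    LinearMap.range (C * A ^ j * F).mulVecLin) j hjs le_rfl ⟨v, rfl⟩)
end

section
/- Let (A,F,C,G) be a discrete-time LTI system of state dimension n (A is n×n, F is n×m, C is p×n, G is p×m, all real), and let s ≥ n. Let r(0), r(1), …, r(s+1) be vectors in ℝ^p. Assume that the finite sequence (r(0),…,r(s)) belongs to the restricted behavior B|_0^s. Then (r(0),…,r(s+1)) belongs to B|_0^(s+1) if and only if the shifted sequence (r(1),…,r(s+1)) belongs to B|_0^s. -/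
/-- The restricted behavior `B|_0^s` of the discrete-time LTI system `(A, F, C, G)`:
the finite sequence `(r 0, …, r s)` is generated by some state trajectory `ξ` and
input trajectory `v` satisfying `ξ (k+1) = A ξ k + F v k` for `k < s` and
`r k = C ξ k + G v k` for `k ≤ s`. -/
def InRestrictedBehavior {n m p : ℕ} (A : Matrix (Fin n) (Fin n) ℝ)
    (F : Matrix (Fin n) (Fin m) ℝ) (C : Matrix (Fin p) (Fin n) ℝ)
    (G : Matrix (Fin p) (Fin m) ℝ) (s : ℕ) (r : ℕ → Fin p → ℝ) : Prop :=
  ∃ ξ : ℕ → Fin n → ℝ, ∃ v : ℕ → Fin m → ℝ,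
    (∀ k < s, ξ (k + 1) = A.mulVec (ξ k) + F.mulVec (v k)) ∧
    (∀ k ≤ s, r k = C.mulVec (ξ k) + G.mulVec (v k))

section OutputNulling

variable {n m p : ℕ} (A : Matrix (Fin n) (Fin n) ℝ) (F : Matrix (Fin n) (Fin m) ℝ)
  (C : Matrix (Fin p) (Fin n) ℝ) (G : Matrix (Fin p) (Fin m) ℝ)

/-- The states from which some input yields zero output and a successor state in `W`. -/
def nullingPreimage (W : Submodule ℝ (Fin n → ℝ)) : Submodule ℝ (Fin n → ℝ) where
  carrier := {x | ∃ u, C.mulVec x + G.mulVec u = 0 ∧ A.mulVec x + F.mulVec u ∈ W}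
  zero_mem' := ⟨0, by simp, by simp⟩
  add_mem' := by
    rintro x y ⟨u, hu, hu'⟩ ⟨w, hw, hw'⟩
    refine ⟨u + w, ?_, ?_⟩
    · rw [Matrix.mulVec_add, Matrix.mulVec_add, add_add_add_comm, hu, hw, add_zero]
    · rw [Matrix.mulVec_add, Matrix.mulVec_add, add_add_add_comm]
      exact W.add_mem hu' hw'
  smul_mem' := by
    rintro c x ⟨u, hu, hu'⟩
    refine ⟨c • u, ?_, ?_⟩
    · rw [Matrix.mulVec_smul, Matrix.mulVec_smul, ← smul_add, hu, smul_zero]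
    · rw [Matrix.mulVec_smul, Matrix.mulVec_smul, ← smul_add]
      exact W.smul_mem c hu'

/-- The states from which some input makes the first `j` outputs vanish. -/
def nullingSubspace : ℕ → Submodule ℝ (Fin n → ℝ)
  | 0 => ⊤
  | j + 1 => nullingPreimage A F C G (nullingSubspace j)

theorem nullingSubspace_succ_le (j : ℕ) :
    nullingSubspace A F C G (j + 1) ≤ nullingSubspace A F C G j := by
  induction j with
  | zero => exact le_top
  | succ j ih =>
    rintro x ⟨u, hu, hu'⟩
    exact ⟨u, hu, ih hu'⟩

theorem nullingSubspace_succ_eq_or_finrank_le (j : ℕ) :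
    nullingSubspace A F C G (j + 1) = nullingSubspace A F C G j ∨
      Module.finrank ℝ (nullingSubspace A F C G (j + 1)) + (j + 1) ≤ n := by
  induction j with
  | zero =>
    refine (nullingSubspace_succ_le A F C G 0).eq_or_lt.imp_right fun hlt => ?_
    have hrank := Submodule.finrank_lt_finrank_of_lt hlt
    have htop : Module.finrank ℝ (nullingSubspace A F C G 0) = n :=
      (finrank_top ℝ (Fin n → ℝ)).trans (by simp)
    omega
  | succ j ih =>
    rcases ih with heq | hle
    · exact Or.inl (congrArg (nullingPreimage A F C G) heq)
    · refine (nullingSubspace_succ_le A F C G (j + 1)).eq_or_lt.imp_right fun hlt => ?_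
      have hrank := Submodule.finrank_lt_finrank_of_lt hlt
      omega

theorem nullingSubspace_succ_eq {j : ℕ} (hj : n ≤ j) :
    nullingSubspace A F C G (j + 1) = nullingSubspace A F C G j :=
  (nullingSubspace_succ_eq_or_finrank_le A F C G j).resolve_right (by omega)

variable {A F C G}

theorem mem_nullingSubspace_of_trajectory (j : ℕ) (ξ : ℕ → Fin n → ℝ) (v : ℕ → Fin m → ℝ)
    (hdyn : ∀ k, k + 1 < j → ξ (k + 1) = A.mulVec (ξ k) + F.mulVec (v k))
    (hout : ∀ k < j, C.mulVec (ξ k) + G.mulVec (v k) = 0) :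
    ξ 0 ∈ nullingSubspace A F C G j := by
  induction j generalizing ξ v with
  | zero => exact Submodule.mem_top
  | succ j ih =>
    refine ⟨v 0, hout 0 j.succ_pos, ?_⟩
    rcases j.eq_zero_or_pos with rfl | hj
    · exact Submodule.mem_top
    · rw [← hdyn 0 (by omega)]
      exact ih (fun k => ξ (k + 1)) (fun k => v (k + 1))
        (fun k hk => hdyn (k + 1) (by omega)) (fun k hk => hout (k + 1) (by omega))

theorem exists_trajectory_of_mem_nullingSubspace (j : ℕ) (x : Fin n → ℝ)
    (hx : x ∈ nullingSubspace A F C G j) :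
    ∃ ξ : ℕ → Fin n → ℝ, ∃ v : ℕ → Fin m → ℝ, ξ 0 = x ∧
      (∀ k < j, ξ (k + 1) = A.mulVec (ξ k) + F.mulVec (v k)) ∧
      (∀ k < j, C.mulVec (ξ k) + G.mulVec (v k) = 0) := by
  induction j generalizing x with
  | zero => exact ⟨fun _ => x, 0, rfl, by simp, by simp⟩
  | succ j ih =>
    obtain ⟨u, hu, hu'⟩ := hx
    obtain ⟨ξ, v, h0, hdyn, hout⟩ := ih _ hu'
    refine ⟨fun k => Nat.casesOn k x ξ, fun k => Nat.casesOn k u v, rfl, ?_, ?_⟩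
    · rintro (_ | k) hk
      · exact h0
      · exact hdyn k (by omega)
    · rintro (_ | k) hk
      · exact hu
      · exact hout k (by omega)

end OutputNulling

/-- Lemma 1: For an LTI system `(A, F, C, G)` of order `n` and `s ≥ n`,
if `(r 0, …, r s) ∈ B|_0^s`, then `(r 0, …, r (s+1)) ∈ B|_0^(s+1)` iff the shifted
sequence `(r 1, …, r (s+1)) ∈ B|_0^s`. -/
theorem behavioral_extension (n m p s : ℕ) (hs : n ≤ s)
    (A : Matrix (Fin n) (Fin n) ℝ) (F : Matrix (Fin n) (Fin m) ℝ)
    (C : Matrix (Fin p) (Fin n) ℝ) (G : Matrix (Fin p) (Fin m) ℝ)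
    (r : ℕ → Fin p → ℝ)
    (h : InRestrictedBehavior A F C G s r) :
    InRestrictedBehavior A F C G (s + 1) r
      ↔ InRestrictedBehavior A F C G s (fun k => r (k + 1)) := by
  constructor
  · rintro ⟨ξ, v, hdyn, hout⟩
    exact ⟨fun k => ξ (k + 1), fun k => v (k + 1),
      fun k hk => hdyn (k + 1) (by omega), fun k hk => hout (k + 1) (by omega)⟩
  · rintro ⟨ξ', v', hdyn', hout'⟩
    obtain ⟨ξ, v, hdyn, hout⟩ := h
    have hmem : A.mulVec (ξ 0) + F.mulVec (v 0) - ξ' 0 ∈ nullingSubspace A F C G s := by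
      rcases s.eq_zero_or_pos with rfl | hpos
      · exact Submodule.mem_top
      · rw [← hdyn 0 hpos]
        refine mem_nullingSubspace_of_trajectory s (fun k => ξ (k + 1) - ξ' k)
          (fun k => v (k + 1) - v' k) (fun k hk => ?_) (fun k hk => ?_)
        · simp only [hdyn (k + 1) hk, hdyn' k (by omega), Matrix.mulVec_sub]
          abel
        · have heq := (hout (k + 1) hk).symm.trans (hout' k hk.le)
          simp only [Matrix.mulVec_sub]
          rw [sub_add_sub_comm, heq, sub_self]
    rw [← nullingSubspace_succ_eq A F C G hs] at hmem
    obtain ⟨ζ, w, h0, hζ, hw⟩ := exists_trajectory_of_mem_nullingSubspace _ _ hmem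
    refine ⟨fun k => Nat.casesOn k (ξ 0) fun k => ξ' k + ζ k,
      fun k => Nat.casesOn k (v 0) fun k => v' k + w k, ?_, ?_⟩
    · rintro (_ | k) hk
      · simp [h0]
      · simp only [hdyn' k (by omega), hζ k (by omega), Matrix.mulVec_add]
        abel
    · rintro (_ | k) hk
      · exact hout 0 s.zero_le
      · simp only [Matrix.mulVec_add]
        rw [add_add_add_comm, hw k (by omega), add_zero]
        exact hout' k (by omega)
end

section
/- Let (A,F,C,G) and (A',F',C',G') be two discrete-time LTI systems with the same state dimension n and the same output dimension p (the input dimensions m and m' may differ). If their restricted behaviors over the window {0,…,n} coincide, i.e., a finite sequence (r(0),…,r(n)) of vectors in ℝ^p belongs to the restricted behavior of the first system if and only if it belongs to the restricted behavior of the second system, then the two systems are output behaviorally equivalent: a sequence r : ℕ → ℝ^p belongs to the output behavior of the first system if and only if it belongs to the output behavior of the second system. -/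
/-- The output behavior of the discrete-time LTI system `(A, F, C, G)`: the sequence
`r : ℕ → ℝ^p` is generated by some state trajectory `ξ` and input trajectory `v`
satisfying `ξ (k+1) = A ξ k + F v k` and `r k = C ξ k + G v k` for all `k`. -/
def InOutputBehavior {n m p : ℕ} (A : Matrix (Fin n) (Fin n) ℝ)
    (F : Matrix (Fin n) (Fin m) ℝ) (C : Matrix (Fin p) (Fin n) ℝ)
    (G : Matrix (Fin p) (Fin m) ℝ) (r : ℕ → Fin p → ℝ) : Prop :=
  ∃ ξ : ℕ → Fin n → ℝ, ∃ v : ℕ → Fin m → ℝ,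
    (∀ k, ξ (k + 1) = A.mulVec (ξ k) + F.mulVec (v k)) ∧
    (∀ k, r k = C.mulVec (ξ k) + G.mulVec (v k))

/-- The image of a subspace `W` under a linear relation `Z` on `X`. -/
def Submodule.relImage {K X : Type*} [Field K] [AddCommGroup X] [Module K X]
    (Z : Submodule K (X × X)) (W : Submodule K X) : Submodule K X :=
  (Z ⊓ W.comap (LinearMap.fst K X X)).map (LinearMap.snd K X X)

section LinearRelation

variable {K X : Type*} [Field K] [AddCommGroup X] [Module K X]

theorem Submodule.mem_relImage {Z : Submodule K (X × X)} {W : Submodule K X} {y : X} :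
    y ∈ Z.relImage W ↔ ∃ x ∈ W, (x, y) ∈ Z := by
  simp only [Submodule.relImage, Submodule.mem_map, Submodule.mem_inf, Submodule.mem_comap,
    LinearMap.fst_apply, LinearMap.snd_apply, Prod.exists]
  constructor
  · rintro ⟨x, _, ⟨hZ, hW⟩, rfl⟩
    exact ⟨x, hW, hZ⟩
  · rintro ⟨x, hW, hZ⟩
    exact ⟨x, y, ⟨hZ, hW⟩, rfl⟩

theorem Submodule.relImage_mono (Z : Submodule K (X × X)) : Monotone Z.relImage := by
  intro V W hVW y hy
  rw [Submodule.mem_relImage] at hy ⊢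
  obtain ⟨x, hx, hxy⟩ := hy
  exact ⟨x, hVW hx, hxy⟩

/-- The iterated images of the whole space are the endpoints of finite paths. -/
theorem Submodule.mem_iterate_relImage_top {Z : Submodule K (X × X)} {k : ℕ} {x : X} :
    x ∈ Z.relImage^[k] ⊤ ↔ ∃ ξ : ℕ → X, ξ k = x ∧ ∀ j < k, (ξ j, ξ (j + 1)) ∈ Z := by
  induction k generalizing x with
  | zero => simpa using ⟨fun _ => x, rfl⟩
  | succ k ih =>
    rw [Function.iterate_succ_apply', Submodule.mem_relImage]
    constructor
    · rintro ⟨y, hy, hyx⟩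
      obtain ⟨ξ, rfl, hξ⟩ := ih.1 hy
      refine ⟨fun j => if j ≤ k then ξ j else x, by simp, fun j hj => ?_⟩
      rcases Nat.lt_succ_iff_lt_or_eq.1 hj with h | rfl
      · simpa [h.le, Nat.succ_le_of_lt h] using hξ j h
      · simpa using hyx
    · rintro ⟨ξ, rfl, hξ⟩
      exact ⟨ξ k, ih.2 ⟨ξ, rfl, fun j hj => hξ j (by omega)⟩, hξ k (by omega)⟩

/-- A monotone operator on subspaces, iterated from the top, stabilizes after `finrank` steps. -/
theorem Submodule.iterate_top_stabilizes [FiniteDimensional K X]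
    {Φ : Submodule K X → Submodule K X} (hΦ : Monotone Φ) {k : ℕ}
    (hk : Module.finrank K X ≤ k) : Φ^[k + 1] ⊤ = Φ^[k] ⊤ := by
  have hanti : ∀ k, Φ^[k + 1] ⊤ ≤ Φ^[k] ⊤ := fun k => by
    rw [Function.iterate_succ_apply]
    exact hΦ.iterate k le_top
  have key : ∀ k, Module.finrank K (Φ^[k] ⊤ : Submodule K X) + k ≤ Module.finrank K X ∨
      Φ^[k + 1] ⊤ = Φ^[k] ⊤ := by
    intro k
    induction k with
    | zero => exact Or.inl (finrank_top K X).le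
    | succ k ih =>
      by_cases heq : Φ^[k + 1] ⊤ = Φ^[k] ⊤
      · right
        rw [Function.iterate_succ_apply', heq, ← Function.iterate_succ_apply' Φ k, heq]
      · left
        have h := ih.resolve_right heq
        have := Submodule.finrank_lt_finrank_of_lt (lt_of_le_of_ne (hanti k) heq)
        omega
  rcases key k with h | h
  · have h0 : Φ^[k] ⊤ = ⊥ := Submodule.finrank_eq_zero.1 (by omega)
    exact le_antisymm (hanti k) (h0 ▸ bot_le)
  · exact h

/-- The endpoint of a path of length at least `finrank` is the endpoint of a longer path. -/
theorem Submodule.exists_longer_path_to [FiniteDimensional K X] (Z : Submodule K (X × X))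
    {k : ℕ} (hk : Module.finrank K X ≤ k) (ξ : ℕ → X)
    (hξ : ∀ j < k, (ξ j, ξ (j + 1)) ∈ Z) :
    ∃ η : ℕ → X, η (k + 1) = ξ k ∧ ∀ j < k + 1, (η j, η (j + 1)) ∈ Z := by
  rw [← Submodule.mem_iterate_relImage_top, Submodule.iterate_top_stabilizes Z.relImage_mono hk,
    Submodule.mem_iterate_relImage_top]
  exact ⟨ξ, rfl, hξ⟩

/-- The starting point of a path of length at least `finrank` starts a longer path. -/
theorem Submodule.exists_longer_path_from [FiniteDimensional K X] (Z : Submodule K (X × X))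
    {k : ℕ} (hk : Module.finrank K X ≤ k) (ξ : ℕ → X)
    (hξ : ∀ j < k, (ξ j, ξ (j + 1)) ∈ Z) :
    ∃ η : ℕ → X, η 0 = ξ 0 ∧ ∀ j < k + 1, (η j, η (j + 1)) ∈ Z := by
  obtain ⟨η, h0, hη⟩ := Submodule.exists_longer_path_to
    (Z.comap (LinearEquiv.prodComm K X X : X × X →ₗ[K] X × X)) hk (fun j => ξ (k - j))
    (fun j hj => by
      have := hξ (k - (j + 1)) (by omega)
      rw [show k - (j + 1) + 1 = k - j by omega] at this
      simpa using this)
  refine ⟨fun j => η (k + 1 - j), by simpa using h0, fun j hj => ?_⟩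
  have := hη (k + 1 - (j + 1)) (by omega)
  rw [show k + 1 - (j + 1) + 1 = k + 1 - j by omega] at this
  simpa using this

variable {Y : Type*} [AddCommGroup Y] [Module K Y]

/-- The state transitions of `S` with zero output. -/
def Submodule.zeroOutput (S : Submodule K (X × Y × X)) : Submodule K (X × X) :=
  S.comap (LinearMap.prod (LinearMap.fst K X X)
    (LinearMap.prod (0 : X × X →ₗ[K] Y) (LinearMap.snd K X X)))

theorem Submodule.mem_zeroOutput {S : Submodule K (X × Y × X)} {x x' : X} :
    (x, x') ∈ S.zeroOutput ↔ (x, (0 : Y), x') ∈ S := Iff.rfl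

theorem Submodule.sub_mem_zeroOutput {S : Submodule K (X × Y × X)} {x x' z z' : X} {y : Y}
    (h : (x, y, x') ∈ S) (h' : (z, y, z') ∈ S) : (x - z, x' - z') ∈ S.zeroOutput := by
  simpa [Submodule.mem_zeroOutput] using S.sub_mem h h'

theorem Submodule.add_mem_of_zeroOutput {S : Submodule K (X × Y × X)} {x x' z z' : X} {y : Y}
    (h : (x, y, x') ∈ S) (h' : (z, z') ∈ S.zeroOutput) : (x + z, y, x' + z') ∈ S := by
  simpa using S.add_mem h (Submodule.mem_zeroOutput.1 h')

/-- Two overlapping trajectories of length `n + 1` with compatible outputs can be glued. -/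
theorem Submodule.exists_glued_path [FiniteDimensional K X] (S : Submodule K (X × Y × X))
    {n : ℕ} (hn : Module.finrank K X ≤ n) (r : ℕ → Y) (ξ θ : ℕ → X)
    (hξ : ∀ j ≤ n, (ξ j, r j, ξ (j + 1)) ∈ S)
    (hθ : ∀ j ≤ n, (θ j, r (j + 1), θ (j + 1)) ∈ S) :
    ∃ ζ : ℕ → X, ∀ j ≤ n + 1, (ζ j, r j, ζ (j + 1)) ∈ S := by
  obtain ⟨η, hend, hη⟩ := S.zeroOutput.exists_longer_path_to hn (fun j => θ j - ξ (j + 1))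
    (fun j hj => Submodule.sub_mem_zeroOutput (hθ j hj.le) (hξ (j + 1) hj))
  refine ⟨fun j => if j ≤ n + 1 then ξ j + η j else θ (n + 1), fun j hj => ?_⟩
  rcases hj.lt_or_eq with h | rfl
  · have := Submodule.add_mem_of_zeroOutput (hξ j (by omega)) (hη j h)
    simpa [hj, Nat.lt_succ_iff.1 h] using this
  · simpa [hend] using hθ n le_rfl

/-- A sequence all of whose windows of length `n + 1` are outputs of finite trajectories
is the output of an infinite trajectory. -/
theorem Submodule.exists_path_of_windows [FiniteDimensional K X] (S : Submodule K (X × Y × X))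
    {n : ℕ} (hn : Module.finrank K X ≤ n) (r : ℕ → Y)
    (hr : ∀ k, ∃ ξ : ℕ → X, ∀ j ≤ n, (ξ j, r (k + j), ξ (j + 1)) ∈ S) :
    ∃ ξ : ℕ → X, ∀ k, (ξ k, r k, ξ (k + 1)) ∈ S := by
  have step : ∀ k (ξ : ℕ → X), (∀ j ≤ n, (ξ j, r (k + j), ξ (j + 1)) ∈ S) →
      ∃ ξ' : ℕ → X, (∀ j ≤ n, (ξ' j, r (k + 1 + j), ξ' (j + 1)) ∈ S) ∧
        (ξ 0, r k, ξ' 0) ∈ S := by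
    intro k ξ hξ
    obtain ⟨θ, hθ⟩ := hr (k + 1)
    obtain ⟨ζ, hζ⟩ := S.exists_glued_path hn (fun j => r (k + j)) ξ θ hξ
      (fun j hj => by simpa only [add_assoc, add_comm 1 j] using hθ j hj)
    obtain ⟨η, hstart, hη⟩ := S.zeroOutput.exists_longer_path_from
      (hn.trans n.le_succ) (fun j => ξ j - ζ j) (fun j hj =>
        Submodule.sub_mem_zeroOutput (hξ j (by omega)) (hζ j (by omega)))
    have hsum : ∀ j ≤ n + 1, (ζ j + η j, r (k + j), ζ (j + 1) + η (j + 1)) ∈ S :=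
      fun j hj => Submodule.add_mem_of_zeroOutput (hζ j hj) (hη j (by omega))
    refine ⟨fun j => ζ (j + 1) + η (j + 1), fun j hj => ?_, ?_⟩
    · simpa only [add_assoc, add_comm 1 j] using hsum (j + 1) (by omega)
    · simpa [hstart] using hsum 0 (by omega)
  choose! next hnext hmem using step
  obtain ⟨ξ₀, hξ₀⟩ := hr 0
  let Ξ : ℕ → ℕ → X := fun k => Nat.rec ξ₀ next k
  have hΞ : ∀ k, ∀ j ≤ n, (Ξ k j, r (k + j), Ξ k (j + 1)) ∈ S := by
    intro k
    induction k with
    | zero => exact hξ₀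
    | succ k ih => exact hnext k (Ξ k) ih
  exact ⟨fun k => Ξ k 0, fun k => hmem k (Ξ k) (hΞ k)⟩

end LinearRelation

/-- The triples `(ξ k, r k, ξ (k + 1))` allowed by the system `(A, F, C, G)`. -/
def transitionSpace {n m p : ℕ} (A : Matrix (Fin n) (Fin n) ℝ) (F : Matrix (Fin n) (Fin m) ℝ)
    (C : Matrix (Fin p) (Fin n) ℝ) (G : Matrix (Fin p) (Fin m) ℝ) :
    Submodule ℝ ((Fin n → ℝ) × (Fin p → ℝ) × (Fin n → ℝ)) :=
  LinearMap.range (LinearMap.prod (LinearMap.fst ℝ (Fin n → ℝ) (Fin m → ℝ))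
    (LinearMap.prod (C.mulVecLin.coprod G.mulVecLin) (A.mulVecLin.coprod F.mulVecLin)))

section LTI

variable {n m p : ℕ} {A : Matrix (Fin n) (Fin n) ℝ} {F : Matrix (Fin n) (Fin m) ℝ}
  {C : Matrix (Fin p) (Fin n) ℝ} {G : Matrix (Fin p) (Fin m) ℝ}

theorem mem_transitionSpace {x x' : Fin n → ℝ} {y : Fin p → ℝ} :
    (x, y, x') ∈ transitionSpace A F C G ↔
      ∃ v, x' = A.mulVec x + F.mulVec v ∧ y = C.mulVec x + G.mulVec v := by
  constructor
  · rintro ⟨⟨x, v⟩, h⟩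
    obtain ⟨rfl, rfl, rfl⟩ : x = _ ∧ C.mulVec x + G.mulVec v = _ ∧ A.mulVec x + F.mulVec v = _ :=
      (Prod.ext_iff.1 h).imp id Prod.ext_iff.1
    exact ⟨v, rfl, rfl⟩
  · rintro ⟨v, rfl, rfl⟩
    exact ⟨(x, v), rfl⟩

theorem inOutputBehavior_iff_exists_path {r : ℕ → Fin p → ℝ} :
    InOutputBehavior A F C G r ↔
      ∃ ξ : ℕ → Fin n → ℝ, ∀ k, (ξ k, r k, ξ (k + 1)) ∈ transitionSpace A F C G := by
  simp only [mem_transitionSpace, InOutputBehavior]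
  refine exists_congr fun ξ => ⟨fun ⟨v, h1, h2⟩ k => ⟨v k, h1 k, h2 k⟩, fun h => ?_⟩
  choose v h1 h2 using h
  exact ⟨v, h1, h2⟩

theorem InRestrictedBehavior.exists_path {s : ℕ} {r : ℕ → Fin p → ℝ}
    (h : InRestrictedBehavior A F C G s r) :
    ∃ ξ : ℕ → Fin n → ℝ, ∀ k ≤ s, (ξ k, r k, ξ (k + 1)) ∈ transitionSpace A F C G := by
  obtain ⟨ξ, v, h1, h2⟩ := h
  refine ⟨fun k => if k ≤ s then ξ k else A.mulVec (ξ s) + F.mulVec (v s), fun k hk => ?_⟩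
  refine mem_transitionSpace.2 ⟨v k, ?_, by simpa [hk] using h2 k hk⟩
  rcases hk.lt_or_eq with h | rfl
  · simpa [hk, Nat.succ_le_of_lt h] using h1 k h
  · simp

theorem InOutputBehavior.inRestrictedBehavior_shift {r : ℕ → Fin p → ℝ}
    (h : InOutputBehavior A F C G r) (s k : ℕ) :
    InRestrictedBehavior A F C G s fun j => r (k + j) := by
  obtain ⟨ξ, v, h1, h2⟩ := h
  exact ⟨fun j => ξ (k + j), fun j => v (k + j), fun j _ => h1 (k + j), fun j _ => h2 (k + j)⟩

theorem inOutputBehavior_iff_forall_window {r : ℕ → Fin p → ℝ} :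
    InOutputBehavior A F C G r ↔
      ∀ k, InRestrictedBehavior A F C G n fun j => r (k + j) :=
  ⟨fun h => h.inRestrictedBehavior_shift n, fun h =>
    inOutputBehavior_iff_exists_path.2 <|
      (transitionSpace A F C G).exists_path_of_windows (n := n) (by simp) r
        fun k => (h k).exists_path⟩

end LTI

/-- Theorem 1: If two LTI systems of the same state dimension `n` and the
same output dimension `p` have equal restricted behaviors over the window `{0, …, n}`,
then they are output behaviorally equivalent. -/
theorem output_behavioral_equivalence (n m m' p : ℕ)
    (A : Matrix (Fin n) (Fin n) ℝ) (F : Matrix (Fin n) (Fin m) ℝ)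
    (C : Matrix (Fin p) (Fin n) ℝ) (G : Matrix (Fin p) (Fin m) ℝ)
    (A' : Matrix (Fin n) (Fin n) ℝ) (F' : Matrix (Fin n) (Fin m') ℝ)
    (C' : Matrix (Fin p) (Fin n) ℝ) (G' : Matrix (Fin p) (Fin m') ℝ)
    (h : ∀ r : ℕ → Fin p → ℝ,
      InRestrictedBehavior A F C G n r ↔ InRestrictedBehavior A' F' C' G' n r) :
    ∀ r : ℕ → Fin p → ℝ,
      InOutputBehavior A F C G r ↔ InOutputBehavior A' F' C' G' r := by
  intro r
  simp only [inOutputBehavior_iff_forall_window, h]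
end

section
/- Let (A,F,C,G) and (A',F',C',G') be two discrete-time LTI systems with the same state dimension n and the same output dimension p, and let s ≥ n. If the restricted behaviors over the window {0,…,s} of the two systems coincide, then the restricted behaviors over the window {0,…,s+1} of the two systems also coincide. -/
/-- The states `x` of the system `(A, F, C, G)` from which the first `k` outputs can be
`r 0, …, r (k - 1)`. -/
def GeneratesFrom {n m p : ℕ} (A : Matrix (Fin n) (Fin n) ℝ)
    (F : Matrix (Fin n) (Fin m) ℝ) (C : Matrix (Fin p) (Fin n) ℝ)
    (G : Matrix (Fin p) (Fin m) ℝ) : ℕ → (ℕ → Fin p → ℝ) → (Fin n → ℝ) → Prop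
  | 0, _, _ => True
  | k + 1, r, x => ∃ v : Fin m → ℝ, r 0 = C.mulVec x + G.mulVec v ∧
      GeneratesFrom A F C G k (fun i => r (i + 1)) (A.mulVec x + F.mulVec v)

section GeneratesFrom

variable {n m p : ℕ} {A : Matrix (Fin n) (Fin n) ℝ} {F : Matrix (Fin n) (Fin m) ℝ}
  {C : Matrix (Fin p) (Fin n) ℝ} {G : Matrix (Fin p) (Fin m) ℝ}

theorem GeneratesFrom.of_succ {k : ℕ} {r : ℕ → Fin p → ℝ} {x : Fin n → ℝ}
    (h : GeneratesFrom A F C G (k + 1) r x) : GeneratesFrom A F C G k r x := by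
  induction k generalizing r x with
  | zero => trivial
  | succ k ih =>
    obtain ⟨v, hv, h⟩ := h
    exact ⟨v, hv, ih h⟩

theorem GeneratesFrom.add {k : ℕ} {r r' : ℕ → Fin p → ℝ} {x x' : Fin n → ℝ}
    (h : GeneratesFrom A F C G k r x) (h' : GeneratesFrom A F C G k r' x') :
    GeneratesFrom A F C G k (r + r') (x + x') := by
  induction k generalizing r r' x x' with
  | zero => trivial
  | succ k ih =>
    obtain ⟨v, hv, h⟩ := h
    obtain ⟨v', hv', h'⟩ := h'
    refine ⟨v + v', ?_, ?_⟩
    · rw [Pi.add_apply, hv, hv', Matrix.mulVec_add, Matrix.mulVec_add, add_add_add_comm]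
    · rw [Matrix.mulVec_add, Matrix.mulVec_add, add_add_add_comm]
      exact ih h h'

theorem GeneratesFrom.smul {k : ℕ} {r : ℕ → Fin p → ℝ} {x : Fin n → ℝ} (c : ℝ)
    (h : GeneratesFrom A F C G k r x) : GeneratesFrom A F C G k (c • r) (c • x) := by
  induction k generalizing r x with
  | zero => trivial
  | succ k ih =>
    obtain ⟨v, hv, h⟩ := h
    refine ⟨c • v, ?_, ?_⟩
    · rw [Pi.smul_apply, hv, Matrix.mulVec_smul, Matrix.mulVec_smul, smul_add]
    · rw [Matrix.mulVec_smul, Matrix.mulVec_smul, ← smul_add]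
      exact ih h

theorem GeneratesFrom.sub {k : ℕ} {r r' : ℕ → Fin p → ℝ} {x x' : Fin n → ℝ}
    (h : GeneratesFrom A F C G k r x) (h' : GeneratesFrom A F C G k r' x') :
    GeneratesFrom A F C G k (r - r') (x - x') := by
  simpa [sub_eq_add_neg] using h.add (h'.smul (-1))

theorem GeneratesFrom.zero (k : ℕ) : GeneratesFrom A F C G k 0 0 := by
  induction k with
  | zero => trivial
  | succ k ih => exact ⟨0, by simp, by rw [Matrix.mulVec_zero, Matrix.mulVec_zero, add_zero]; exact ih⟩

theorem generatesFrom_succ_iff_exists_trajectory {s : ℕ} {r : ℕ → Fin p → ℝ} {x : Fin n → ℝ} :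
    GeneratesFrom A F C G (s + 1) r x ↔
      ∃ ξ : ℕ → Fin n → ℝ, ∃ v : ℕ → Fin m → ℝ, ξ 0 = x ∧
        (∀ k < s, ξ (k + 1) = A.mulVec (ξ k) + F.mulVec (v k)) ∧
        (∀ k ≤ s, r k = C.mulVec (ξ k) + G.mulVec (v k)) := by
  induction s generalizing r x with
  | zero =>
    constructor
    · rintro ⟨v, hv, -⟩
      refine ⟨fun _ => x, fun _ => v, rfl, by simp, fun k hk => ?_⟩
      rw [Nat.le_zero.mp hk, hv]
    · rintro ⟨ξ, v, rfl, -, hr⟩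
      exact ⟨v 0, hr 0 le_rfl, trivial⟩
  | succ s ih =>
    constructor
    · rintro ⟨v₀, hv, h⟩
      obtain ⟨ξ, v, h0, hξ, hr⟩ := ih.mp h
      refine ⟨fun k => k.casesOn x ξ, fun k => k.casesOn v₀ v, rfl, ?_, ?_⟩
      · rintro (_ | k) hk
        · exact h0
        · exact hξ k (by omega)
      · rintro (_ | k) hk
        · exact hv
        · exact hr k (by omega)
    · rintro ⟨ξ, v, rfl, hξ, hr⟩
      refine ⟨v 0, hr 0 (Nat.zero_le _), ih.mpr
        ⟨fun k => ξ (k + 1), fun k => v (k + 1), hξ 0 (Nat.succ_pos s), ?_, ?_⟩⟩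
      · exact fun k hk => hξ (k + 1) (by omega)
      · exact fun k hk => hr (k + 1) (by omega)

theorem inRestrictedBehavior_iff_exists_generatesFrom {s : ℕ} {r : ℕ → Fin p → ℝ} :
    InRestrictedBehavior A F C G s r ↔ ∃ x, GeneratesFrom A F C G (s + 1) r x := by
  simp only [generatesFrom_succ_iff_exists_trajectory]
  constructor
  · rintro ⟨ξ, v, h⟩
    exact ⟨ξ 0, ξ, v, rfl, h⟩
  · rintro ⟨_, ξ, v, -, h⟩
    exact ⟨ξ, v, h⟩

variable (A F C G) in
/-- The subspace of states from which the first `k` outputs can all be zero. -/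
def weaklyUnobservable (k : ℕ) : Submodule ℝ (Fin n → ℝ) where
  carrier := {x | GeneratesFrom A F C G k 0 x}
  add_mem' h h' := by simpa using GeneratesFrom.add h h'
  zero_mem' := GeneratesFrom.zero k
  smul_mem' c _ h := by simpa using GeneratesFrom.smul c h

theorem weaklyUnobservable_succ_le (k : ℕ) :
    weaklyUnobservable A F C G (k + 1) ≤ weaklyUnobservable A F C G k :=
  fun _ h => GeneratesFrom.of_succ h

theorem weaklyUnobservable_succ_eq_succ {k : ℕ}
    (h : weaklyUnobservable A F C G (k + 1) = weaklyUnobservable A F C G k) :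
    weaklyUnobservable A F C G (k + 2) = weaklyUnobservable A F C G (k + 1) := by
  refine le_antisymm (weaklyUnobservable_succ_le _) ?_
  rintro x ⟨v, hv, hx⟩
  exact ⟨v, hv, h.ge hx⟩

theorem weaklyUnobservable_succ_eq_or_finrank_add_le (k : ℕ) :
    weaklyUnobservable A F C G (k + 1) = weaklyUnobservable A F C G k ∨
      Module.finrank ℝ (weaklyUnobservable A F C G k) + k ≤ n := by
  induction k with
  | zero =>
    right
    simpa using Submodule.finrank_le (weaklyUnobservable A F C G 0)
  | succ k ih =>
    by_cases h : weaklyUnobservable A F C G (k + 1) = weaklyUnobservable A F C G k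
    · exact .inl (weaklyUnobservable_succ_eq_succ h)
    · have hlt := Submodule.finrank_lt_finrank_of_lt
        (lt_of_le_of_ne (weaklyUnobservable_succ_le k) h)
      have := ih.resolve_left h
      right
      omega

theorem weaklyUnobservable_succ_eq_of_le {s : ℕ} (hs : n ≤ s) :
    weaklyUnobservable A F C G (s + 1) = weaklyUnobservable A F C G s := by
  induction s, hs using Nat.le_induction with
  | base =>
    refine (weaklyUnobservable_succ_eq_or_finrank_add_le n).elim id fun h => ?_
    have hbot : weaklyUnobservable A F C G n = ⊥ :=
      Submodule.finrank_eq_zero.mp (by omega)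
    exact le_antisymm (weaklyUnobservable_succ_le n) (hbot ▸ bot_le)
  | succ s _ ih => exact weaklyUnobservable_succ_eq_succ ih

theorem inRestrictedBehavior_succ_iff {s : ℕ} (hs : n ≤ s) {r : ℕ → Fin p → ℝ} :
    InRestrictedBehavior A F C G (s + 1) r ↔
      InRestrictedBehavior A F C G s r ∧
        InRestrictedBehavior A F C G s (fun i => r (i + 1)) := by
  simp only [inRestrictedBehavior_iff_exists_generatesFrom]
  constructor
  · rintro ⟨x, h⟩
    obtain ⟨v, -, h'⟩ := id h
    exact ⟨⟨x, h.of_succ⟩, _, h'⟩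
  · rintro ⟨⟨x, v, hv, hx⟩, y, hy⟩
    have hdiff : A.mulVec x + F.mulVec v - y ∈ weaklyUnobservable A F C G s := by
      have := hx.sub hy.of_succ
      rwa [sub_self] at this
    have hsum := GeneratesFrom.add ((weaklyUnobservable_succ_eq_of_le hs).ge hdiff) hy
    rw [zero_add, sub_add_cancel] at hsum
    exact ⟨x, v, hv, hsum⟩

end GeneratesFrom

/-- For two LTI systems with the same state dimension `n` and output
dimension `p`, and `s ≥ n`: if the restricted behaviors over the window `{0, …, s}`
of the two systems coincide, then so do the restricted behaviors over `{0, …, s+1}`. -/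
theorem restricted_behavior_extension (n m m' p s : ℕ) (hs : n ≤ s)
    (A : Matrix (Fin n) (Fin n) ℝ) (F : Matrix (Fin n) (Fin m) ℝ)
    (C : Matrix (Fin p) (Fin n) ℝ) (G : Matrix (Fin p) (Fin m) ℝ)
    (A' : Matrix (Fin n) (Fin n) ℝ) (F' : Matrix (Fin n) (Fin m') ℝ)
    (C' : Matrix (Fin p) (Fin n) ℝ) (G' : Matrix (Fin p) (Fin m') ℝ)
    (h : ∀ r : ℕ → Fin p → ℝ,
      InRestrictedBehavior A F C G s r ↔ InRestrictedBehavior A' F' C' G' s r) :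
    ∀ r : ℕ → Fin p → ℝ,
      InRestrictedBehavior A F C G (s + 1) r
        ↔ InRestrictedBehavior A' F' C' G' (s + 1) r := by
  intro r
  rw [inRestrictedBehavior_succ_iff hs, inRestrictedBehavior_succ_iff hs, h, h]
end

section
/- Let (A,F,C,G) be a discrete-time LTI system (A is n×n, F is n×m, C is p×n, G is p×m, all real). Suppose there exists a complex number z such that the (n+p)×(n+m) complex block matrix H(z) = [[A − z·I, F],[C, G]] (with the real entries regarded as complex numbers) has rank n+p, i.e., full row rank. Then the output behavior of the system is the whole space: for every sequence r : ℕ → ℝ^p there exist ξ : ℕ → ℝ^n and v : ℕ → ℝ^m with ξ(k+1) = A ξ(k) + F v(k) and r(k) = C ξ(k) + G v(k) for all k ∈ ℕ. -/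
open Polynomial in
/-- A nonzero polynomial in the shift operator is surjective on scalar sequences. -/
theorem aeval_shift_surjective {K : Type*} [Field K] [IsAlgClosed K] {d : K[X]} (hd : d ≠ 0) :
    Function.Surjective (aeval (LinearMap.funLeft K K Nat.succ) d) := by
  have hlin (a : K) :
      Function.Surjective (aeval (LinearMap.funLeft K K Nat.succ) (X - C a)) := by
    intro b
    refine ⟨fun k => Nat.rec 0 (fun j y => a * y + b j) k, ?_⟩
    ext k
    simp [LinearMap.funLeft, Module.algebraMap_end_apply]
  have hprod (s : Multiset K) : Function.Surjective
      (aeval (LinearMap.funLeft K K Nat.succ) (s.map fun a => X - C a).prod) := by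
    induction s using Multiset.induction with
    | empty => exact fun b => ⟨b, by simp⟩
    | cons a s ih =>
      rw [Multiset.map_cons, Multiset.prod_cons, map_mul, Module.End.mul_eq_comp,
        LinearMap.coe_comp]
      exact (hlin a).comp ih
  rw [(IsAlgClosed.splits d).eq_prod_roots, map_mul, Module.End.mul_eq_comp, LinearMap.coe_comp]
  refine Function.Surjective.comp (fun b => ⟨d.leadingCoeff⁻¹ • b, ?_⟩) (hprod _)
  simp [Module.algebraMap_end_apply, smul_smul, hd]

open Polynomial in
/-- A polynomial matrix in the shift operator that has full row rank at some point is surjective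
on vector-valued sequences. -/
theorem exists_sum_aeval_shift_eq {K ι κ : Type*} [Field K] [IsAlgClosed K]
    [Fintype ι] [Fintype κ] (P : Matrix ι κ K[X]) (z : K)
    (h : (P.map (eval z)).rank = Fintype.card ι) (b : ι → ℕ → K) :
    ∃ u : κ → ℕ → K, ∀ i,
      ∑ j, aeval (LinearMap.funLeft K K Nat.succ) (P i j) (u j) = b i := by
  classical
  obtain ⟨R, hR⟩ : ∃ R : Matrix κ ι K, P.map (eval z) * R = 1 := by
    rw [← Matrix.mulVec_surjective_iff_exists_right_inverse]
    refine LinearMap.range_eq_top.mp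
      (Submodule.eq_top_of_finrank_eq (K := K) (S := (P.map (eval z)).mulVecLin.range) ?_)
    rw [Module.finrank_fintype_fun_eq_card]
    exact h
  set Q := P * R.map C with hQ
  have hdet : Q.det ≠ 0 := by
    intro h0
    have hmap : Q.map (evalRingHom z) = 1 := by
      rw [hQ, Matrix.map_mul, Matrix.map_map, ← hR]
      congr 1
      ext
      simp
    have := RingHom.map_det (evalRingHom z) Q
    rw [h0, RingHom.mapMatrix_apply, hmap] at this
    simp at this
  set N := R.map C * Q.adjugate with hN
  have hPN : P * N = Q.det • 1 := by
    rw [hN, ← Matrix.mul_assoc, ← hQ, Matrix.mul_adjugate]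
  choose w hw using fun i => aeval_shift_surjective hdet (b i)
  refine ⟨fun j => ∑ l, aeval (LinearMap.funLeft K K Nat.succ) (N j l) (w l), fun i => ?_⟩
  calc _ = ∑ l, aeval (LinearMap.funLeft K K Nat.succ) ((P * N) i l) (w l) := by
        simp only [map_sum, Matrix.mul_apply, map_mul, LinearMap.sum_apply, Module.End.mul_apply]
        exact Finset.sum_comm
    _ = b i := by
        rw [hPN, Finset.sum_eq_single i]
        · simpa using hw i
        · intro l _ hl
          simp [Matrix.one_apply_ne' hl]
        · simp

/-- Proposition 2: If the Rosenbrock system matrix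
`H(z) = [[A - z I, F], [C, G]]` (over `ℂ`) has full row rank `n + p` at some point
`z ∈ ℂ`, then the output behavior of the LTI system `(A, F, C, G)` is the whole space:
every sequence `r : ℕ → ℝ^p` is generated by some state and input trajectories. -/
theorem full_behavior_of_rosenbrock_full_row_rank (n m p : ℕ)
    (A : Matrix (Fin n) (Fin n) ℝ) (F : Matrix (Fin n) (Fin m) ℝ)
    (C : Matrix (Fin p) (Fin n) ℝ) (G : Matrix (Fin p) (Fin m) ℝ)
    (h : ∃ z : ℂ,
      (Matrix.fromBlocks
        (A.map ((↑) : ℝ → ℂ) - z • (1 : Matrix (Fin n) (Fin n) ℂ)) (F.map ((↑) : ℝ → ℂ))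
        (C.map ((↑) : ℝ → ℂ)) (G.map ((↑) : ℝ → ℂ))).rank = n + p) :
    ∀ r : ℕ → Fin p → ℝ, ∃ ξ : ℕ → Fin n → ℝ, ∃ v : ℕ → Fin m → ℝ,
      (∀ k, ξ (k + 1) = A.mulVec (ξ k) + F.mulVec (v k)) ∧
      (∀ k, r k = C.mulVec (ξ k) + G.mulVec (v k)) := by
  obtain ⟨z, hz⟩ := h
  intro r
  let P : Matrix (Fin n ⊕ Fin p) (Fin n ⊕ Fin m) (Polynomial ℂ) :=
    Matrix.fromBlocks
      (A.map (fun a => Polynomial.C (a : ℂ)) - (Polynomial.X : Polynomial ℂ) • 1)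
      (F.map fun a => Polynomial.C (a : ℂ))
      (C.map fun a => Polynomial.C (a : ℂ)) (G.map fun a => Polynomial.C (a : ℂ))
  have hP : (P.map (Polynomial.eval z)).rank = Fintype.card (Fin n ⊕ Fin p) := by
    rw [Fintype.card_sum, Fintype.card_fin, Fintype.card_fin, ← hz]
    congr 1
    ext (i | i) (j | j) <;> simp [P, Matrix.one_apply, apply_ite (Polynomial.eval z)]
  obtain ⟨u, hu⟩ := exists_sum_aeval_shift_eq P z hP
    (Sum.elim (fun _ _ => 0) fun i k => (r k i : ℂ))
  refine ⟨fun k i => (u (Sum.inl i) k).re, fun k j => (u (Sum.inr j) k).re,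
    fun k => funext fun i => ?_, fun k => funext fun i => ?_⟩
  · have hX (j : Fin n) : Polynomial.aeval (LinearMap.funLeft ℂ ℂ Nat.succ)
        (if i = j then (Polynomial.X : Polynomial ℂ) else 0) (u (Sum.inl j)) k =
          if i = j then u (Sum.inl j) (k + 1) else 0 := by
      split_ifs <;> simp [LinearMap.funLeft_apply]
    have := congrArg Complex.re (congrFun (hu (Sum.inl i)) k)
    simp [P, Matrix.one_apply, Module.algebraMap_end_apply, Finset.sum_sub_distrib, hX] at this
    simp [Matrix.mulVec, dotProduct]
    linarith
  · have := congrArg Complex.re (congrFun (hu (Sum.inr i)) k)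
    simp [P, Module.algebraMap_end_apply] at this
    simp [Matrix.mulVec, dotProduct, ← this]
end

section
/- Let (A,F,C,G) be a discrete-time LTI system (A is n×n, F is n×m, C is p×n, G is p×m, all real) and let r : ℕ → ℝ^p. If for every s ∈ ℕ the finite prefix (r(0),…,r(s)) belongs to the restricted behavior B|_0^s, then r belongs to the output behavior B(A,F,C,G), i.e., there exist ξ : ℕ → ℝ^n and v : ℕ → ℝ^m with ξ(k+1) = A ξ(k) + F v(k) and r(k) = C ξ(k) + G v(k) for all k ∈ ℕ. -/
/-- The states `x` from which some input produces the output `y` and leads to a state in `K`. -/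
def outputPredecessors {n m p : ℕ} (A : Matrix (Fin n) (Fin n) ℝ)
    (F : Matrix (Fin n) (Fin m) ℝ) (C : Matrix (Fin p) (Fin n) ℝ)
    (G : Matrix (Fin p) (Fin m) ℝ) (y : Fin p → ℝ) (K : AffineSubspace ℝ (Fin n → ℝ)) :
    AffineSubspace ℝ (Fin n → ℝ) where
  carrier := {x | ∃ v, y = C.mulVec x + G.mulVec v ∧ A.mulVec x + F.mulVec v ∈ K}
  smul_vsub_vadd_mem' := by
    rintro c x₁ x₂ x₃ ⟨v₁, h₁, k₁⟩ ⟨v₂, h₂, k₂⟩ ⟨v₃, h₃, k₃⟩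
    refine ⟨c • (v₁ - v₂) + v₃, ?_, ?_⟩
    · have e : c • (y - y) + y = y := by simp
      rw [← e]
      nth_rewrite 1 [h₁]
      nth_rewrite 1 [h₂]
      nth_rewrite 1 [h₃]
      simp only [vsub_eq_sub, vadd_eq_add, Matrix.mulVec_add, Matrix.mulVec_smul,
        Matrix.mulVec_sub]
      module
    · convert K.smul_vsub_vadd_mem c k₁ k₂ k₃ using 1
      simp only [vsub_eq_sub, vadd_eq_add, Matrix.mulVec_add, Matrix.mulVec_smul,
        Matrix.mulVec_sub]
      module

/-- The states at time `t` from which the outputs `r t, …, r (t + j - 1)` can be produced. -/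
def consistentStates {n m p : ℕ} (A : Matrix (Fin n) (Fin n) ℝ)
    (F : Matrix (Fin n) (Fin m) ℝ) (C : Matrix (Fin p) (Fin n) ℝ)
    (G : Matrix (Fin p) (Fin m) ℝ) (r : ℕ → Fin p → ℝ) :
    ℕ → ℕ → AffineSubspace ℝ (Fin n → ℝ)
  | _, 0 => ⊤
  | t, j + 1 => outputPredecessors A F C G (r t) (consistentStates A F C G r (t + 1) j)

theorem antitone_consistentStates {n m p : ℕ} (A : Matrix (Fin n) (Fin n) ℝ)
    (F : Matrix (Fin n) (Fin m) ℝ) (C : Matrix (Fin p) (Fin n) ℝ)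
    (G : Matrix (Fin p) (Fin m) ℝ) (r : ℕ → Fin p → ℝ) (t : ℕ) :
    Antitone (consistentStates A F C G r t) := by
  refine antitone_nat_of_succ_le fun j => ?_
  induction j generalizing t with
  | zero => exact le_top
  | succ j ih =>
    rintro x ⟨v, hy, hv⟩
    exact ⟨v, hy, ih (t + 1) hv⟩

theorem InRestrictedBehavior.nonempty_consistentStates {n m p : ℕ}
    {A : Matrix (Fin n) (Fin n) ℝ} {F : Matrix (Fin n) (Fin m) ℝ}
    {C : Matrix (Fin p) (Fin n) ℝ} {G : Matrix (Fin p) (Fin m) ℝ} {r : ℕ → Fin p → ℝ}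
    {t j : ℕ} (h : InRestrictedBehavior A F C G (t + j) r) :
    (consistentStates A F C G r t j : Set (Fin n → ℝ)).Nonempty := by
  obtain ⟨ξ, v, hξ, hr⟩ := h
  have key : ∀ i u, u + i ≤ t + j → ξ u ∈ consistentStates A F C G r u i := by
    intro i
    induction i with
    | zero => exact fun u _ => AffineSubspace.mem_top ℝ _ _
    | succ i ih =>
      intro u hu
      refine ⟨v u, hr u (by omega), ?_⟩
      rw [← hξ u (by omega)]
      exact ih (u + 1) (by omega)
  exact ⟨ξ t, key j t le_rfl⟩

/-- A decreasing sequence of nonempty affine subspaces of a finite-dimensional space stabilizes. -/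
theorem AffineSubspace.exists_forall_ge_eq_of_antitone {k V P : Type*} [DivisionRing k]
    [AddCommGroup V] [Module k V] [FiniteDimensional k V] [AddTorsor V P]
    {S : ℕ → AffineSubspace k P} (hS : Antitone S) (hne : ∀ i, (S i : Set P).Nonempty) :
    ∃ N, ∀ i, N ≤ i → S i = S N := by
  obtain ⟨N, hN⟩ := IsArtinian.monotone_stabilizes (R := k) (M := V)
    ⟨fun i => OrderDual.toDual (S i).direction,
      fun _ _ hij => AffineSubspace.direction_le (hS hij)⟩
  exact ⟨N, fun i hi => AffineSubspace.eq_of_direction_eq_of_nonempty_of_le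
    (congrArg OrderDual.ofDual (hN i hi)).symm (hne i) (hS hi)⟩

/-- If every finite prefix `(r 0, …, r s)` of `r : ℕ → ℝ^p` belongs to the
restricted behavior `B|_0^s` of the LTI system `(A, F, C, G)`, then `r` belongs to its
(infinite-horizon) output behavior. -/
theorem output_behavior_of_all_prefixes (n m p : ℕ)
    (A : Matrix (Fin n) (Fin n) ℝ) (F : Matrix (Fin n) (Fin m) ℝ)
    (C : Matrix (Fin p) (Fin n) ℝ) (G : Matrix (Fin p) (Fin m) ℝ)
    (r : ℕ → Fin p → ℝ)
    (h : ∀ s : ℕ, InRestrictedBehavior A F C G s r) :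
    ∃ ξ : ℕ → Fin n → ℝ, ∃ v : ℕ → Fin m → ℝ,
      (∀ k, ξ (k + 1) = A.mulVec (ξ k) + F.mulVec (v k)) ∧
      (∀ k, r k = C.mulVec (ξ k) + G.mulVec (v k)) := by
  have hstab : ∀ t, ∃ N, ∀ i, N ≤ i →
      consistentStates A F C G r t i = consistentStates A F C G r t N := fun t =>
    AffineSubspace.exists_forall_ge_eq_of_antitone (antitone_consistentStates A F C G r t)
      fun i => (h (t + i)).nonempty_consistentStates
  choose N hN using hstab
  have hmem : ∀ t x, x ∈ consistentStates A F C G r t (N t) →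
      ∀ i, x ∈ consistentStates A F C G r t i := by
    intro t x hx i
    rw [← hN t (max i (N t)) (le_max_right _ _)] at hx
    exact antitone_consistentStates A F C G r t (le_max_left _ _) hx
  have hstep : ∀ t x, ∃ v, x ∈ consistentStates A F C G r t (N t) →
      r t = C.mulVec x + G.mulVec v ∧
        A.mulVec x + F.mulVec v ∈ consistentStates A F C G r (t + 1) (N (t + 1)) := by
    intro t x
    by_cases hx : x ∈ consistentStates A F C G r t (N t)
    · obtain ⟨v, hv⟩ := hmem t x hx (N (t + 1) + 1)
      exact ⟨v, fun _ => hv⟩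
    · exact ⟨0, fun hx' => absurd hx' hx⟩
  choose u hu using hstep
  obtain ⟨x₀, hx₀⟩ := (h (0 + N 0)).nonempty_consistentStates
  let ξ : ℕ → Fin n → ℝ := Nat.rec x₀ fun t x => A.mulVec x + F.mulVec (u t x)
  have hξ : ∀ t, ξ t ∈ consistentStates A F C G r t (N t) := by
    intro t
    induction t with
    | zero => exact hx₀
    | succ t ih => exact (hu t _ ih).2
  exact ⟨ξ, fun t => u t (ξ t), fun _ => rfl, fun t => (hu t _ (hξ t)).1⟩
end

section
/- Let (A,F,C,G) be a discrete-time LTI system (A is n×n, F is n×m, C is p×n, G is p×m, all real), let s ≥ 2, and let T_s be its block lower-triangular Toeplitz matrix with s block rows. Let Q be an (s·p)×c real matrix, partitioned into s block rows Q_1,…,Q_s (each p×c), such that the column space of T_s is contained in the column space of Q. Then there exist matrices Z_1,…,Z_s ∈ ℝ^(c×m) satisfying: (a) Q_i·Z_j = 0 for all 1 ≤ i < j ≤ s; (b) Q_i·Z_j = Q_{i+1}·Z_{j+1} for all 1 ≤ j ≤ i ≤ s−1; (c) Q_{k+1}·Z_1 = C·A^(k−1)·F for all 1 ≤ k ≤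 s−1 (i.e., the stack of Q_2,…,Q_s times Z_1 equals the extended observability matrix O_{s−1} times F); and (d) Q_1·Z_1 = G. -/
/-- The block lower-triangular Toeplitz matrix `T_s` with `s` block rows (each block
`p × m`, 0-indexed): block `(i, j)` is `G` if `i = j`, `C * A ^ (i - j - 1) * F` if
`j < i`, and `0` otherwise. -/
def toeplitzMatrix {n m p : ℕ} (A : Matrix (Fin n) (Fin n) ℝ)
    (F : Matrix (Fin n) (Fin m) ℝ) (C : Matrix (Fin p) (Fin n) ℝ)
    (G : Matrix (Fin p) (Fin m) ℝ) (s : ℕ) :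
    Matrix (Fin s × Fin p) (Fin s × Fin m) ℝ :=
  Matrix.of fun ia jb =>
    if (ia.1 : ℕ) = (jb.1 : ℕ) then G ia.2 jb.2
    else if (jb.1 : ℕ) < (ia.1 : ℕ) then (C * A ^ ((ia.1 : ℕ) - (jb.1 : ℕ) - 1) * F) ia.2 jb.2
    else 0

/-- The `i`-th block row (a `p × c` matrix) of an `(s·p) × c` matrix `Q`. -/
def blockRow {s p c : ℕ} (Q : Matrix (Fin s × Fin p) (Fin c) ℝ) (i : Fin s) :
    Matrix (Fin p) (Fin c) ℝ :=
  Matrix.of fun a j => Q (i, a) j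

/-- If the range of `M` is contained in the range of `Q`, then `M` factors through `Q`. -/
theorem Matrix.exists_eq_mul_of_range_mulVecLin_le {R ι κ l : Type*} [CommSemiring R]
    [Fintype κ] [Fintype l] {M : Matrix ι κ R} {Q : Matrix ι l R}
    (h : LinearMap.range M.mulVecLin ≤ LinearMap.range Q.mulVecLin) :
    ∃ X : Matrix l κ R, M = Q * X := by
  classical
  have hcol (j : κ) : ∃ x : l → R, Q.mulVec x = M.col j := by
    obtain ⟨x, hx⟩ := h ⟨Pi.single j 1, rfl⟩
    exact ⟨x, by simpa using hx⟩
  choose x hx using hcol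
  refine ⟨Matrix.of fun a j => x j a, ?_⟩
  ext i j
  exact (congrFun (hx j) i).symm

/-- The `(i, j)` block of the Toeplitz matrix. -/
theorem toeplitzMatrix_block {n m p s : ℕ} (A : Matrix (Fin n) (Fin n) ℝ)
    (F : Matrix (Fin n) (Fin m) ℝ) (C : Matrix (Fin p) (Fin n) ℝ)
    (G : Matrix (Fin p) (Fin m) ℝ) (i j : Fin s) :
    (toeplitzMatrix A F C G s).submatrix (Prod.mk i) (Prod.mk j) =
      if (i : ℕ) = j then G
      else if (j : ℕ) < i then C * A ^ ((i : ℕ) - j - 1) * F else 0 := by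
  ext a b
  simp only [toeplitzMatrix, Matrix.submatrix_apply, Matrix.of_apply]
  split_ifs <;> rfl

/-- If the column space of the Toeplitz matrix `T_s` of the system
`(A, F, C, G)` is contained in the column space of `Q` (with `s ≥ 2`), then there exist
matrices `Z_1, …, Z_s` satisfying the structural equations (9): (a) `Q_i Z_j = 0` for
`i < j`; (b) `Q_i Z_j = Q_{i+1} Z_{j+1}` for `j ≤ i` (when `i+1` is still a valid
block index); (c) `Q_{k+1} Z_1 = C A^(k-1) F` for `1 ≤ k ≤ s - 1`; (d) `Q_1 Z_1 = G`.
(Blocks are 0-indexed here, so `Z_1` of the paper is `Z ⟨0, _⟩`.) -/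
theorem exists_Z_of_toeplitz_column_space (n m p s c : ℕ) (hs : 2 ≤ s)
    (A : Matrix (Fin n) (Fin n) ℝ) (F : Matrix (Fin n) (Fin m) ℝ)
    (C : Matrix (Fin p) (Fin n) ℝ) (G : Matrix (Fin p) (Fin m) ℝ)
    (Q : Matrix (Fin s × Fin p) (Fin c) ℝ)
    (hQ : LinearMap.range (toeplitzMatrix A F C G s).mulVecLin
      ≤ LinearMap.range Q.mulVecLin) :
    ∃ Z : Fin s → Matrix (Fin c) (Fin m) ℝ,
      (∀ i j : Fin s, i < j → blockRow Q i * Z j = 0) ∧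
      (∀ (i j : ℕ) (hi : i + 1 < s) (hj : j ≤ i),
        blockRow Q ⟨i, Nat.lt_of_succ_lt hi⟩
            * Z ⟨j, lt_of_le_of_lt hj (Nat.lt_of_succ_lt hi)⟩
          = blockRow Q ⟨i + 1, hi⟩
            * Z ⟨j + 1, Nat.lt_of_le_of_lt (Nat.succ_le_succ hj) hi⟩) ∧
      (∀ (k : ℕ) (hk1 : 1 ≤ k) (hk : k < s),
        blockRow Q ⟨k, hk⟩ * Z ⟨0, lt_of_le_of_lt (Nat.zero_le k) hk⟩
          = C * A ^ (k - 1) * F) ∧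
      (blockRow Q ⟨0, by omega⟩ * Z ⟨0, by omega⟩ = G) := by
  obtain ⟨X, hX⟩ := Matrix.exists_eq_mul_of_range_mulVecLin_le hQ
  have hZ (i j : Fin s) : blockRow Q i * X.submatrix id (Prod.mk j) =
      if (i : ℕ) = j then G
      else if (j : ℕ) < i then C * A ^ ((i : ℕ) - j - 1) * F else 0 := by
    rw [← toeplitzMatrix_block, hX]
    rfl
  refine ⟨fun j => X.submatrix id (Prod.mk j), fun i j hij => ?_, fun i j hi hj => ?_,
    fun k hk1 hk => ?_, ?_⟩
  · have hij' : (i : ℕ) < j := hij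
    rw [hZ, if_neg hij'.ne, if_neg hij'.not_gt]
  · simp only [hZ, Nat.add_right_cancel_iff, Nat.add_lt_add_iff_right, Nat.add_sub_add_right]
  · rw [hZ, if_neg (Nat.ne_of_gt hk1), if_pos (Nat.pos_of_ne_zero (Nat.ne_of_gt hk1))]
    simp
  · simp [hZ]
end

section
/- Let A be n×n, C be p×n real matrices, let s ≥ 2, let Q be an (s·p)×c real matrix partitioned into s block rows Q_1,…,Q_s (each p×c), and let Z_1,…,Z_s ∈ ℝ^(c×w) and F̂ ∈ ℝ^(n×w) satisfy: (a) Q_i·Z_j = 0 for all 1 ≤ i < j ≤ s; (b) Q_i·Z_j = Q_{i+1}·Z_{j+1} for all 1 ≤ j ≤ i ≤ s−1; and (c) Q_{k+1}·Z_1 = C·A^(k−1)·F̂ for all 1 ≤ k ≤ s−1. Define Ĝ := Q_1·Z_1. Then Q·[Z_1 Z_2 ⋯ Z_s] (the product of Q with the horizontal concatenation of Z_1,…,Z_s) equals the block lower-triangular Toeplitz matrix T̂_s of the system (A, F̂, C, Ĝ): its (i,j) block (1-indexed, each block p×w) is Ĝ if i = j, C·A^(i−j−1)·F̂ if i > j,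 and 0 if i < j. -/
/-- The horizontal concatenation `[Z_1 Z_2 ⋯ Z_s]` of the `c × w` matrices `Z j`. -/
def hcat {s c w : ℕ} (Z : Fin s → Matrix (Fin c) (Fin w) ℝ) :
    Matrix (Fin c) (Fin s × Fin w) ℝ :=
  Matrix.of fun a jb => Z jb.1 a jb.2

/-- Block products constant along diagonals reduce to the first block column. -/
theorem blockRow_mul_add {s p c w : ℕ} (Q : Matrix (Fin s × Fin p) (Fin c) ℝ)
    (Z : Fin s → Matrix (Fin c) (Fin w) ℝ)
    (hb : ∀ (i j : ℕ) (hi : i + 1 < s) (hj : j ≤ i),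
      blockRow Q ⟨i, Nat.lt_of_succ_lt hi⟩
          * Z ⟨j, lt_of_le_of_lt hj (Nat.lt_of_succ_lt hi)⟩
        = blockRow Q ⟨i + 1, hi⟩
          * Z ⟨j + 1, Nat.lt_of_le_of_lt (Nat.succ_le_succ hj) hi⟩)
    (d j : ℕ) (h : d + j < s) :
    blockRow Q ⟨d + j, h⟩ * Z ⟨j, by omega⟩
      = blockRow Q ⟨d, by omega⟩ * Z ⟨0, by omega⟩ := by
  induction j with
  | zero => rfl
  | succ j ih => exact (hb (d + j) j h (by omega)).symm.trans (ih (by omega))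

/-- The blocks of `Q * hcat Z` are the products of block rows of `Q` with the `Z j`. -/
theorem mul_hcat_apply {s p c w : ℕ} (Q : Matrix (Fin s × Fin p) (Fin c) ℝ)
    (Z : Fin s → Matrix (Fin c) (Fin w) ℝ) (i j : Fin s) (a : Fin p) (b : Fin w) :
    (Q * hcat Z) (i, a) (j, b) = (blockRow Q i * Z j) a b :=
  rfl

/-- converse of the fault-matrix recovery construction: if `Z_1, …, Z_s`
and `F̂` satisfy the structural equations (a) `Q_i Z_j = 0` for `i < j`,
(b) `Q_i Z_j = Q_{i+1} Z_{j+1}` for `j ≤ i`, and (c) `Q_{k+1} Z_1 = C A^(k-1) F̂` for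
`1 ≤ k ≤ s - 1`, then with `Ĝ := Q_1 Z_1` the product `Q · [Z_1 ⋯ Z_s]` equals the
block lower-triangular Toeplitz matrix of the system `(A, F̂, C, Ĝ)`.
(Blocks are 0-indexed here, so `Z_1` of the paper is `Z ⟨0, _⟩`.) -/
theorem toeplitz_of_Z_solution (n p s c w : ℕ) (hs : 2 ≤ s)
    (A : Matrix (Fin n) (Fin n) ℝ) (C : Matrix (Fin p) (Fin n) ℝ)
    (Q : Matrix (Fin s × Fin p) (Fin c) ℝ)
    (Z : Fin s → Matrix (Fin c) (Fin w) ℝ) (Fhat : Matrix (Fin n) (Fin w) ℝ)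
    (ha : ∀ i j : Fin s, i < j → blockRow Q i * Z j = 0)
    (hb : ∀ (i j : ℕ) (hi : i + 1 < s) (hj : j ≤ i),
      blockRow Q ⟨i, Nat.lt_of_succ_lt hi⟩
          * Z ⟨j, lt_of_le_of_lt hj (Nat.lt_of_succ_lt hi)⟩
        = blockRow Q ⟨i + 1, hi⟩
          * Z ⟨j + 1, Nat.lt_of_le_of_lt (Nat.succ_le_succ hj) hi⟩)
    (hc : ∀ (k : ℕ) (hk1 : 1 ≤ k) (hk : k < s),
      blockRow Q ⟨k, hk⟩ * Z ⟨0, lt_of_le_of_lt (Nat.zero_le k) hk⟩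
        = C * A ^ (k - 1) * Fhat)
    (Ghat : Matrix (Fin p) (Fin w) ℝ)
    (hG : Ghat = blockRow Q ⟨0, by omega⟩ * Z ⟨0, by omega⟩) :
    Q * hcat Z = Matrix.of fun (ia : Fin s × Fin p) (jb : Fin s × Fin w) =>
      if (ia.1 : ℕ) = (jb.1 : ℕ) then Ghat ia.2 jb.2
      else if (jb.1 : ℕ) < (ia.1 : ℕ) then
        (C * A ^ ((ia.1 : ℕ) - (jb.1 : ℕ) - 1) * Fhat) ia.2 jb.2
      else 0 := by
  ext ⟨⟨i, hi⟩, a⟩ ⟨⟨j, hj⟩, b⟩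
  rw [mul_hcat_apply]
  simp only [Matrix.of_apply]
  rcases lt_or_ge i j with hij | hij
  · rw [ha _ _ hij, if_neg hij.ne, if_neg hij.not_gt, Matrix.zero_apply]
  · obtain ⟨d, rfl⟩ := Nat.exists_eq_add_of_le' hij
    rw [blockRow_mul_add Q Z hb d j hi]
    rcases Nat.eq_zero_or_pos d with rfl | hd
    · rw [if_pos (Nat.zero_add j), hG]
    · rw [if_neg (by omega), if_pos (by omega), hc d hd (by omega), Nat.add_sub_cancel]
end
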